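/- In the algebra Uı, for all integers t ≥ 0 and l ≥ 0, the following identity holds: (B₂^{(t)} B₁^{(l+t)} B₂^{(l)}) · B₁ = [t+1] · ( B₂^{(t)} B₁^{(l+t+1)} B₂^{(l)} + B₂^{(t+1)} B₁^{(l+t+1)} B₂^{(l−1)} − {k₁⁻¹; t − l − 1/2} · B₂^{(t)} B₁^{(l+t)} B₂^{(l−1)} ), where divided powers with negative superscript are zero. -/

import Mathlib

noncomputable section

namespace UiAIII

/-- The base field `K = ℚ(t)`, where `q := t²`. -/
abbrev K : Type := RatFunc ℚ

/-- `t^s` for `s : ℤ`; so `tz (2*n)` represents `q^n` and `tz s` represents `q^{s/2}`. -/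
def tz (s : ℤ) : K := (RatFunc.X : K) ^ s

/-- The quantum integer `[n] = (q^n - q^{-n})/(q - q^{-1})`, with `q = t²`. -/
def qint (n : ℤ) : K := (tz (2 * n) - tz (-(2 * n))) / (tz 2 - tz (-2))

/-- The quantum factorial `[n]!`. -/
def qfact (n : ℕ) : K := ∏ i ∈ Finset.range n, qint ((i : ℤ) + 1)

variable {A : Type*} [Ring A] [Algebra K A]

/-- Divided power `x^{(m)} = x^m/[m]!` for `m ≥ 0`, and `0` for `m < 0`. -/
def dp (x : A) (m : ℤ) : A := if 0 ≤ m then (qfact m.toNat)⁻¹ • x ^ m.toNat else 0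

/-- `{k; s/2} := q^{s/2}·k + q^{-s/2}·k⁻¹`; the argument `s` is twice the half-integer. -/
def brace (k kinv : A) (s : ℤ) : A := tz s • k + tz (-s) • kinv

/-- `k^j` for `j : ℤ`, using the two-sided inverse `kinv` of `k`. -/
def upow (k kinv : A) (j : ℤ) : A := if 0 ≤ j then k ^ j.toNat else kinv ^ (-j).toNat

end UiAIII

open UiAIII

namespace UiAIII

theorem X_pow_four_sub_one_ne_zero : (RatFunc.X : K) ^ 4 - 1 ≠ 0 := by
  have h : (Polynomial.X ^ 4 - 1 : Polynomial ℚ) ≠ 0 := by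
    simpa using Polynomial.X_pow_sub_C_ne_zero (n := 4) (by norm_num) (1 : ℚ)
  have h' := RatFunc.algebraMap_ne_zero (K := ℚ) h
  simpa [RatFunc.algebraMap_X] using h'

theorem tz_add (a b : ℤ) : tz (a + b) = tz a * tz b := zpow_add₀ RatFunc.X_ne_zero a b

theorem tz_zero : tz 0 = 1 := zpow_zero _

theorem qint_zero : qint 0 = 0 := by simp [qint]

theorem qint_eq (n : ℤ) :
    qint n = ((RatFunc.X ^ n) ^ 4 - 1) * RatFunc.X ^ 2 /
      ((RatFunc.X ^ n) ^ 2 * ((RatFunc.X : K) ^ 4 - 1)) := by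
  have hX : (RatFunc.X : K) ≠ 0 := RatFunc.X_ne_zero
  have hu : (RatFunc.X : K) ^ n ≠ 0 := zpow_ne_zero n hX
  have h4 := X_pow_four_sub_one_ne_zero
  have e : (RatFunc.X : K) ^ (2 * n) = (RatFunc.X ^ n) ^ 2 := by
    rw [mul_comm, zpow_mul]; rfl
  have e2 : (RatFunc.X : K) ^ (2 : ℤ) = RatFunc.X ^ 2 := rfl
  have hd : (RatFunc.X : K) ^ 2 - (RatFunc.X ^ 2)⁻¹ ≠ 0 := by
    intro h
    apply h4
    field_simp at h
    linear_combination h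
  rw [qint, tz, tz, tz, tz, zpow_neg, zpow_neg, e, e2]
  field_simp

theorem qint_one : qint 1 = 1 := by
  rw [qint_eq, zpow_one]
  have hX : (RatFunc.X : K) ≠ 0 := RatFunc.X_ne_zero
  have h4 := X_pow_four_sub_one_ne_zero
  field_simp

theorem qint_ne_zero {n : ℕ} (hn : n ≠ 0) : qint n ≠ 0 := by
  have hX : (RatFunc.X : K) ≠ 0 := RatFunc.X_ne_zero
  have h4 := X_pow_four_sub_one_ne_zero
  have h : (RatFunc.X : K) ^ (n * 4) - 1 ≠ 0 := by
    have h : (Polynomial.X ^ (n * 4) - 1 : Polynomial ℚ) ≠ 0 := by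
      simpa using Polynomial.X_pow_sub_C_ne_zero (n := n * 4) (by omega) (1 : ℚ)
    simpa [RatFunc.algebraMap_X] using RatFunc.algebraMap_ne_zero (K := ℚ) h
  rw [qint_eq, zpow_natCast, ← pow_mul]
  positivity

theorem qfact_succ (n : ℕ) : qfact (n + 1) = qfact n * qint ((n : ℤ) + 1) :=
  Finset.prod_range_succ _ _

theorem qfact_ne_zero (n : ℕ) : qfact n ≠ 0 :=
  Finset.prod_ne_zero_iff.mpr fun i _ => by exact_mod_cast qint_ne_zero i.succ_ne_zero

section Commutation

local instance : Algebra ℕ K := Semiring.toNatAlgebra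

local instance : Algebra ℤ K := Ring.toIntAlgebra K

variable {A : Type*} [Ring A] [Algebra K A] {x y k k' : A}

theorem pow_mul_eq_tz_smul {a : ℤ} (h : x * k = tz a • (k * x)) (n : ℕ) :
    x ^ n * k = tz (a * n) • (k * x ^ n) := by
  induction n with
  | zero => simp [tz_zero]
  | succ n ih =>
    rw [pow_succ, mul_assoc, h, mul_smul_comm, ← mul_assoc, ih, smul_mul_assoc, smul_smul,
      ← tz_add, mul_assoc]
    congr 2
    push_cast
    ring

theorem mul_inv_eq_tz_smul {a : ℤ} (hk : k * k' = 1) (hk' : k' * k = 1)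
    (h : k * x = tz a • (x * k)) : x * k' = tz a • (k' * x) := by
  calc x * k' = k' * (k * x) * k' := by rw [← mul_assoc, hk', one_mul]
    _ = tz a • (k' * x) := by
      rw [h, mul_smul_comm, smul_mul_assoc, mul_assoc, mul_assoc, hk, mul_one]

theorem mul_eq_tz_neg_smul {a : ℤ} (h : k * x = tz a • (x * k)) :
    x * k = tz (-a) • (k * x) := by
  rw [h, smul_smul, ← tz_add, neg_add_cancel, tz_zero, one_smul]

theorem pow_succ_mul_eq (hx : x * k = tz (-6) • (k * x)) (hx' : x * k' = tz 6 • (k' * x))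
    (hS : x ^ 2 * y - qint 2 • (x * y * x) + y * x ^ 2
      = qint 2 • (x * (tz 3 • k + tz (-3) • k'))) (n : ℕ) :
    x ^ (n + 1) * y = qint ((n : ℤ) + 1) • (x * y * x ^ n) - qint n • (y * x ^ (n + 1))
      + (qint n * qint ((n : ℤ) + 1)) •
        ((tz (-(2 * n + 1)) • k + tz (2 * n + 1) • k') * x ^ n) := by
  have hX : (RatFunc.X : K) ≠ 0 := RatFunc.X_ne_zero
  have h4 := X_pow_four_sub_one_ne_zero
  induction n with
  | zero => simp [qint_zero, qint_one]
  | succ n ih =>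
    have h1 := congrArg (x * ·) ih
    have h2 := congrArg (· * x ^ n) hS
    have e : x * (k * x ^ n) = tz (-6) • (k * x ^ (n + 1)) := by
      rw [← mul_assoc, hx, smul_mul_assoc, mul_assoc, ← pow_succ']
    have e' : x * (k' * x ^ n) = tz 6 • (k' * x ^ (n + 1)) := by
      rw [← mul_assoc, hx', smul_mul_assoc, mul_assoc, ← pow_succ']
    have e1 (z : A) : x * (x ^ (n + 1) * z) = x ^ (n + 2) * z := by
      rw [← mul_assoc, ← pow_succ']
    have e2 : x * x ^ n = x ^ (n + 1) := (pow_succ' x n).symm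
    have e3 (z : A) : x * (x * z) = x ^ 2 * z := by rw [← mul_assoc, ← pow_two]
    have e4 : x ^ 2 * x ^ n = x ^ (n + 2) := by rw [← pow_add, add_comm]
    simp only [mul_add, add_mul, mul_sub, sub_mul, mul_smul_comm, smul_mul_assoc, mul_assoc,
      e, e', e1, e2, e3, e4] at h1 h2 ⊢
    rw [h1, ← sub_eq_zero]
    linear_combination (norm := skip) qint ((n : ℤ) + 1) • h2
    match_scalars
    all_goals
      simp only [qint_eq, tz, neg_add, zpow_add₀ hX, zpow_neg, zpow_mul', zpow_ofNat]
      field_simp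
    all_goals ring

theorem qint_smul_pow_mul_mul (hx : x * k = tz (-6) • (k * x))
    (hx' : x * k' = tz 6 • (k' * x))
    (hS : x ^ 2 * y - qint 2 • (x * y * x) + y * x ^ 2
      = qint 2 • (x * (tz 3 • k + tz (-3) • k'))) (m : ℕ) :
    qint ((m : ℤ) + 1) • (x ^ m * y * x) = qint m • (x ^ (m + 1) * y) + y * x ^ (m + 1)
      - (qint m * qint ((m : ℤ) + 1)) •
        ((tz (-(4 * m - 1)) • k + tz (4 * m - 1) • k') * x ^ m) := by
  have hX : (RatFunc.X : K) ≠ 0 := RatFunc.X_ne_zero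
  have h4 := X_pow_four_sub_one_ne_zero
  cases m with
  | zero => simp [qint_zero, qint_one]
  | succ j =>
    have h1 := congrArg (· * x) (pow_succ_mul_eq hx hx' hS j)
    have h2 := pow_succ_mul_eq hx hx' hS (j + 1)
    simp only [add_mul, sub_mul, smul_mul_assoc, mul_assoc, ← pow_succ] at h1 h2 ⊢
    rw [h1, h2]
    match_scalars
    all_goals
      simp only [qint_eq, tz, neg_add, neg_sub, zpow_add₀ hX, zpow_sub₀ hX, zpow_neg, zpow_mul',
        zpow_ofNat]
      field_simp
    all_goals ring

theorem qint_smul_pow_mul_pow_mul_pow_mul {a b : A}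
    (hak : a * k = tz 6 • (k * a)) (hak' : a * k' = tz (-6) • (k' * a))
    (hbk : b * k = tz (-6) • (k * b)) (hbk' : b * k' = tz 6 • (k' * b))
    (ha : a ^ 2 * b - qint 2 • (a * b * a) + b * a ^ 2
      = qint 2 • (a * (tz (-3) • k + tz 3 • k')))
    (hb : b ^ 2 * a - qint 2 • (b * a * b) + a * b ^ 2
      = qint 2 • (b * (tz 3 • k + tz (-3) • k'))) (t n : ℕ) :
    qint ((n : ℤ) + t + 2) • (b ^ t * (a ^ (n + t + 1) * (b ^ (n + 1) * a)))
      = qint ((t : ℤ) + 1) • (b ^ t * (a ^ (n + t + 2) * b ^ (n + 1)))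
        + qint ((n : ℤ) + 1) • (b ^ (t + 1) * (a ^ (n + t + 2) * b ^ n))
        - (qint ((n : ℤ) + t + 2) * qint ((n : ℤ) + 1) * qint ((t : ℤ) + 1)) •
          ((tz (2 * t - 2 * n - 3) • k' + tz (-(2 * t - 2 * n - 3)) • k) *
            (b ^ t * (a ^ (n + t + 1) * b ^ n))) := by
  have hX : (RatFunc.X : K) ≠ 0 := RatFunc.X_ne_zero
  have h4 := X_pow_four_sub_one_ne_zero
  have h1 := congrArg (b ^ t * a ^ (n + t + 1) * ·) (pow_succ_mul_eq hbk hbk' hb n)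
  have h2 := congrArg (b ^ t * · * b ^ n) (qint_smul_pow_mul_mul (k := k') (k' := k) hak' hak
    (by rw [ha, add_comm (tz 3 • k')]) (n + t + 1))
  have hb1 : b * b ^ n = b ^ (n + 1) := (pow_succ' b n).symm
  have haa (z : A) : a ^ (n + t + 1) * (a * z) = a ^ (n + t + 2) * z := by
    rw [← mul_assoc, ← pow_succ]
  have hbt (z : A) : b ^ t * (b * z) = b ^ (t + 1) * z := by rw [← mul_assoc, ← pow_succ]
  have hka (z : A) : a ^ (n + t + 1) * (k * z)
      = tz (6 * (n + t + 1 : ℕ)) • (k * (a ^ (n + t + 1) * z)) := by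
    rw [← mul_assoc, pow_mul_eq_tz_smul hak, smul_mul_assoc, mul_assoc]
  have hka' (z : A) : a ^ (n + t + 1) * (k' * z)
      = tz (-6 * (n + t + 1 : ℕ)) • (k' * (a ^ (n + t + 1) * z)) := by
    rw [← mul_assoc, pow_mul_eq_tz_smul hak', smul_mul_assoc, mul_assoc]
  have hkb (z : A) : b ^ t * (k * z) = tz (-6 * t) • (k * (b ^ t * z)) := by
    rw [← mul_assoc, pow_mul_eq_tz_smul hbk, smul_mul_assoc, mul_assoc]
  have hkb' (z : A) : b ^ t * (k' * z) = tz (6 * t) • (k' * (b ^ t * z)) := by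
    rw [← mul_assoc, pow_mul_eq_tz_smul hbk', smul_mul_assoc, mul_assoc]
  simp only [mul_add, add_mul, mul_sub, sub_mul, mul_smul_comm, smul_mul_assoc, mul_assoc,
    hka, hka', hkb, hkb', hb1, hbt, haa] at h1 h2 ⊢
  rw [h1, ← sub_eq_zero]
  linear_combination (norm := skip) qint ((n : ℤ) + 1) • h2
  match_scalars
  all_goals
    simp only [qint_eq, tz, neg_add, neg_sub, zpow_add₀ hX, zpow_sub₀ hX, zpow_neg, zpow_mul',
      zpow_ofNat]
    field_simp
  all_goals ring

end Commutation

theorem dp_natCast {A : Type*} [Ring A] [Algebra K A] (x : A) (n : ℕ) :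
    dp x n = (qfact n)⁻¹ • x ^ n := by simp [dp]

theorem dp_natCast_add_one {A : Type*} [Ring A] [Algebra K A] (x : A) (n : ℕ) :
    dp x ((n : ℤ) + 1) = (qfact n * qint ((n : ℤ) + 1))⁻¹ • x ^ (n + 1) := by
  rw [← qfact_succ]
  exact_mod_cast dp_natCast x (n + 1)

theorem dp_neg_one {A : Type*} [Ring A] [Algebra K A] (x : A) : dp x (-1) = 0 := by simp [dp]

end UiAIII

/-- Identity (4.12) of the paper: for all `t, l ≥ 0`,
`(B₂^{(t)}B₁^{(l+t)}B₂^{(l)})·B₁ = [t+1]·( B₂^{(t)}B₁^{(l+t+1)}B₂^{(l)}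
   + B₂^{(t+1)}B₁^{(l+t+1)}B₂^{(l−1)} − {k₁⁻¹; t−l−1/2}·B₂^{(t)}B₁^{(l+t)}B₂^{(l−1)} )`,
in any algebra with elements satisfying the defining relations of the quasi-split iquantum
group Uı of type AIII for sl₃ with parameters ς₁ = ς₂ = −q^{1/2}. -/
theorem statement5 (A : Type*) [Ring A] [Algebra K A]
    (B1 B2 k1 k1' : A)
    (hk : k1 * k1' = 1) (hk' : k1' * k1 = 1)
    (hkB1 : k1 * B1 = tz (-6) • (B1 * k1))
    (hkB2 : k1 * B2 = tz 6 • (B2 * k1))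
    (hS1 : B1 ^ 2 * B2 - qint 2 • (B1 * B2 * B1) + B2 * B1 ^ 2
        = qint 2 • (B1 * (tz (-3) • k1 + tz 3 • k1')))
    (hS2 : B2 ^ 2 * B1 - qint 2 • (B2 * B1 * B2) + B1 * B2 ^ 2
        = qint 2 • (B2 * (tz 3 • k1 + tz (-3) • k1')))
    (t l : ℕ) :
    (dp B2 (t : ℤ) * dp B1 ((l : ℤ) + t) * dp B2 (l : ℤ)) * B1
      = qint ((t : ℤ) + 1) •
          (dp B2 (t : ℤ) * dp B1 ((l : ℤ) + t + 1) * dp B2 (l : ℤ)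
            + dp B2 ((t : ℤ) + 1) * dp B1 ((l : ℤ) + t + 1) * dp B2 ((l : ℤ) - 1)
            - brace k1' k1 (2 * (t : ℤ) - 2 * (l : ℤ) - 1) *
                (dp B2 (t : ℤ) * dp B1 ((l : ℤ) + t) * dp B2 ((l : ℤ) - 1))) := by
  have h11 := mul_eq_tz_neg_smul hkB1
  have h12 := mul_eq_tz_neg_smul hkB2
  have h11' := mul_inv_eq_tz_smul hk hk' hkB1
  have h12' := mul_inv_eq_tz_smul hk hk' hkB2
  have ht : qint ((t : ℤ) + 1) ≠ 0 := by exact_mod_cast qint_ne_zero t.succ_ne_zero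
  have hft := qfact_ne_zero t
  rcases l with _ | n
  · have e0 : ((0 : ℕ) : ℤ) + t = t := by simp
    have e1 : ((0 : ℕ) : ℤ) - 1 = -1 := by simp
    rw [e0, e1, dp_neg_one, mul_zero, mul_zero, mul_zero, add_zero, sub_zero]
    simp only [dp_natCast, dp_natCast_add_one, pow_zero, mul_smul_comm, smul_mul_assoc,
      mul_assoc, smul_smul, mul_one, ← pow_succ]
    congr 1
    field_simp
  · have h := qint_smul_pow_mul_pow_mul_pow_mul h11 h11' h12 h12' hS1 hS2 t n
    have e0 : (((n + 1 : ℕ) : ℤ) + t) = ((n + t + 1 : ℕ) : ℤ) := by push_cast; ring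
    have e1 : (((n + 1 : ℕ) : ℤ) - 1) = (n : ℤ) := by simp
    have e2 : 2 * (t : ℤ) - 2 * ((n + 1 : ℕ) : ℤ) - 1 = 2 * t - 2 * n - 3 := by push_cast; ring
    have e3 : ((n + t + 1 : ℕ) : ℤ) + 1 = (n : ℤ) + t + 2 := by push_cast; ring
    have hm : qint ((n : ℤ) + t + 2) ≠ 0 := by
      exact_mod_cast qint_ne_zero (n := n + t + 2) (by omega)
    have hn : qint ((n : ℤ) + 1) ≠ 0 := by exact_mod_cast qint_ne_zero n.succ_ne_zero
    have hfn := qfact_ne_zero n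
    have hfm := qfact_ne_zero (n + t + 1)
    have h' := congrArg (((qfact t)⁻¹ * (qfact (n + t + 1))⁻¹ * (qfact (n + 1))⁻¹ *
      (qint ((n : ℤ) + t + 2))⁻¹) • ·) h
    rw [e0, e1, e2, dp_natCast_add_one B1, e3]
    simp only [dp_natCast, dp_natCast_add_one, qfact_succ n, brace,
      mul_smul_comm, smul_mul_assoc, mul_assoc, smul_smul, smul_add, smul_sub, add_mul] at h' ⊢
    convert h' using 1
    · congr 1
      field_simp
    · congr 2
      all_goals congr 1; field_simp
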